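/- Averaging the observations is statistically suboptimal: in the sequence-model setup, assume additionally that the averaged eigenvalues D̄_{nj} := (1/n) Σ_{i=1}^n D_{ij} are nonzero for every j, and define the averaged statistic B̄_{nj} := conj(D̄_{nj}) X̄_{nj} / |D̄_{nj}|², where X̄_n := Ψ* Ȳ_n and Ȳ_n := (1/n) Σ_{i=1}^n Y_i. Let R₁ := inf_{λ ∈ ℂ^p} E‖Ψ λ(B_n) − θ‖² and R₂ := inf_{λ ∈ ℂ^p} E‖Ψ λ(B̄_n) − θ‖² be the oracle linear risks based on B_n and on B̄_n respectively. Then R₁ ≤ R₂ always, and if in addition there exists an index j such that β_j = (Ψ*θ)_j ≠ 0 and the scalars D_{1j}, …, D_{nj} are not all equal, then R₁ < R₂ strictly. -/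

import Mathlib

open MeasureTheory ProbabilityTheory Matrix

/-- The joint law of `n` independent standard Gaussian vectors in `ℝ^p`. -/
noncomputable def noiseLaw (n p : ℕ) : Measure (Fin n → Fin p → ℝ) :=
  Measure.pi fun _ => Measure.pi fun _ => gaussianReal 0 1

/-- A sum of centred square-integrable functions of independent coordinates is centred and
square-integrable, and its second moment is the sum of the individual second moments. -/
lemma memLp_integral_sum_pi {ι Ω : Type*} [Fintype ι] [MeasurableSpace Ω]
    {μ : Measure Ω} [IsProbabilityMeasure μ] {f : ι → Ω → ℝ}
    (hf : ∀ i, MemLp (f i) 2 μ) (hf0 : ∀ i, ∫ x, f i x ∂μ = 0) :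
    MemLp (fun w : ι → Ω => ∑ i, f i (w i)) 2 (Measure.pi fun _ => μ) ∧
      ∫ w, ∑ i, f i (w i) ∂(Measure.pi fun _ : ι => μ) = 0 ∧
      ∫ w, (∑ i, f i (w i)) ^ 2 ∂(Measure.pi fun _ : ι => μ) = ∑ i, ∫ x, f i x ^ 2 ∂μ := by
  have hmem : ∀ i, MemLp (fun w : ι → Ω => f i (w i)) 2 (Measure.pi fun _ => μ) := fun i =>
    (hf i).comp_measurePreserving (measurePreserving_eval (fun _ => μ) i)
  have hsum : MemLp (fun w : ι → Ω => ∑ i, f i (w i)) 2 (Measure.pi fun _ => μ) :=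
    memLp_finsetSum _ fun i _ => hmem i
  have hmean : ∫ w, ∑ i, f i (w i) ∂(Measure.pi fun _ : ι => μ) = 0 := by
    rw [integral_finsetSum _ fun i _ => (hmem i).integrable (by norm_num)]
    refine Finset.sum_eq_zero fun i _ => ?_
    rw [integral_comp_eval (μ := fun _ : ι => μ) (hf i).aestronglyMeasurable, hf0]
  refine ⟨hsum, hmean, ?_⟩
  rw [← variance_of_integral_eq_zero hsum.aestronglyMeasurable.aemeasurable hmean]
  have hv := variance_sum_pi (μ := fun _ : ι => μ) hf
  have hfun : (∑ i, fun w : ι → Ω => f i (w i)) = fun w => ∑ i, f i (w i) := by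
    ext w; simp
  rw [hfun] at hv
  rw [hv]
  exact Finset.sum_congr rfl fun i _ =>
    variance_of_integral_eq_zero (hf i).aestronglyMeasurable.aemeasurable (hf0 i)

/-- Moments of a real linear form in the noise. -/
lemma memLp_integral_linear_noiseLaw {n p : ℕ} (u : Fin n → Fin p → ℝ) :
    MemLp (fun w => ∑ i, ∑ k, u i k * w i k) 2 (noiseLaw n p) ∧
      ∫ w, ∑ i, ∑ k, u i k * w i k ∂(noiseLaw n p) = 0 ∧
      ∫ w, (∑ i, ∑ k, u i k * w i k) ^ 2 ∂(noiseLaw n p) = ∑ i, ∑ k, u i k ^ 2 := by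
  have hid : MemLp (fun x : ℝ => x) 2 (gaussianReal 0 1) :=
    memLp_id_gaussianReal' 2 (by norm_num)
  have hsq : ∫ x, x ^ 2 ∂(gaussianReal 0 1) = 1 := by
    rw [← variance_of_integral_eq_zero (X := fun x : ℝ => x) (by fun_prop)
      integral_id_gaussianReal]
    simp
  have hrow := fun i => memLp_integral_sum_pi (μ := gaussianReal 0 1)
    (f := fun k x => u i k * x) (fun k => hid.const_mul (u i k))
    (fun k => by rw [integral_const_mul, integral_id_gaussianReal, mul_zero])
  obtain ⟨h1, h2, h3⟩ := memLp_integral_sum_pi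
    (f := fun i (x : Fin p → ℝ) => ∑ k, u i k * x k)
    (fun i => (hrow i).1) (fun i => (hrow i).2.1)
  refine ⟨h1, h2, h3.trans (Finset.sum_congr rfl fun i _ => ?_)⟩
  rw [(hrow i).2.2]
  refine Finset.sum_congr rfl fun k _ => ?_
  simp_rw [mul_pow]
  rw [integral_const_mul, hsq, mul_one]

instance (n p : ℕ) : IsProbabilityMeasure (noiseLaw n p) := by
  unfold noiseLaw; infer_instance

/-- Second moment of a real affine form in the noise. -/
lemma integrable_integral_sq_affine_noiseLaw {n p : ℕ} (a : ℝ) (u : Fin n → Fin p → ℝ) :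
    Integrable (fun w => (a + ∑ i, ∑ k, u i k * w i k) ^ 2) (noiseLaw n p) ∧
      ∫ w, (a + ∑ i, ∑ k, u i k * w i k) ^ 2 ∂(noiseLaw n p)
        = a ^ 2 + ∑ i, ∑ k, u i k ^ 2 := by
  obtain ⟨h1, h2, h3⟩ := memLp_integral_linear_noiseLaw u
  have hL := h1.integrable (by norm_num)
  refine ⟨((memLp_const a).add h1).integrable_sq, ?_⟩
  have hLa : Integrable (fun w => a ^ 2 + 2 * a * ∑ i, ∑ k, u i k * w i k) (noiseLaw n p) :=
    (integrable_const _).add (hL.const_mul _)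
  simp_rw [add_sq]
  rw [integral_add hLa h1.integrable_sq,
    integral_add (integrable_const _) (hL.const_mul _), integral_const_mul, h2, h3]
  simp

/-- Second moment of a complex affine form in the noise. -/
lemma integrable_integral_normSq_affine_noiseLaw {n p : ℕ} (a : ℂ) (m : Fin n → Fin p → ℂ) :
    Integrable (fun w => ‖a + ∑ i, ∑ k, m i k * (w i k : ℂ)‖ ^ 2) (noiseLaw n p) ∧
      ∫ w, ‖a + ∑ i, ∑ k, m i k * (w i k : ℂ)‖ ^ 2 ∂(noiseLaw n p)
        = ‖a‖ ^ 2 + ∑ i, ∑ k, ‖m i k‖ ^ 2 := by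
  obtain ⟨hr, hr'⟩ := integrable_integral_sq_affine_noiseLaw a.re fun i k => (m i k).re
  obtain ⟨hi, hi'⟩ := integrable_integral_sq_affine_noiseLaw a.im fun i k => (m i k).im
  have hsplit : ∀ w : Fin n → Fin p → ℝ, ‖a + ∑ i, ∑ k, m i k * (w i k : ℂ)‖ ^ 2
      = (a.re + ∑ i, ∑ k, (m i k).re * w i k) ^ 2
        + (a.im + ∑ i, ∑ k, (m i k).im * w i k) ^ 2 := fun w => by
    rw [← Complex.normSq_eq_norm_sq, Complex.normSq_apply]
    simp [pow_two]
  simp_rw [hsplit]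
  refine ⟨hr.add hi, ?_⟩
  rw [integral_add hr hi, hr', hi']
  simp_rw [← Complex.normSq_eq_norm_sq, Complex.normSq_apply, ← pow_two, Finset.sum_add_distrib]
  ring

/-- Multiplication by a matrix with orthonormal columns preserves the sum of squared moduli. -/
lemma sum_norm_sq_mulVec {p : ℕ} {Ψ : Matrix (Fin p) (Fin p) ℂ} (hΨ : Ψᴴ * Ψ = 1)
    (u : Fin p → ℂ) : ∑ j, ‖Ψ.mulVec u j‖ ^ 2 = ∑ j, ‖u j‖ ^ 2 := by
  have hdot : ∀ v : Fin p → ℂ, star v ⬝ᵥ v = ((∑ j, ‖v j‖ ^ 2 : ℝ) : ℂ) := fun v => by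
    simp [dotProduct, Complex.conj_mul']
  have h : star (Ψ.mulVec u) ⬝ᵥ Ψ.mulVec u = star u ⬝ᵥ u := by
    rw [star_mulVec, ← dotProduct_mulVec, mulVec_mulVec, hΨ, one_mulVec]
  rw [hdot, hdot] at h
  exact_mod_cast h

/-- The risk of a linear estimator based on an unbiased linear statistic splits into squared
bias and variance, component by component. -/
lemma integral_risk_eq {n p : ℕ} {θ : Fin p → ℝ} {ε : ℝ} {Ψ : Matrix (Fin p) (Fin p) ℂ}
    (hΨ : Ψ * Ψᴴ = 1 ∧ Ψᴴ * Ψ = 1) {β : Fin p → ℂ}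
    (hβ : β = Ψᴴ.mulVec fun j => (θ j : ℂ)) (c : Fin n → Fin p → ℂ)
    {S : (Fin n → Fin p → ℝ) → Fin p → ℂ}
    (hS : ∀ w j, S w j = β j
      + ∑ i, c i j * ((ε : ℂ) * (Ψᴴ.mulVec fun k => ((w i k : ℝ) : ℂ)) j))
    (lam : Fin p → ℂ) :
    ∫ w, (∑ j, ‖Ψ.mulVec (fun j' => lam j' * S w j') j - (θ j : ℂ)‖ ^ 2) ∂(noiseLaw n p)
      = ∑ j, (‖lam j - 1‖ ^ 2 * ‖β j‖ ^ 2 + ε ^ 2 * (∑ i, ‖c i j‖ ^ 2) * ‖lam j‖ ^ 2) := by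
  have hθ : (fun j => (θ j : ℂ)) = Ψ.mulVec β := by
    rw [hβ, mulVec_mulVec, hΨ.1, one_mulVec]
  have hpt : ∀ w, (∑ j, ‖Ψ.mulVec (fun j' => lam j' * S w j') j - (θ j : ℂ)‖ ^ 2)
      = ∑ j, ‖(lam j - 1) * β j
        + ∑ i, ∑ k, (lam j * c i j * ε * Ψᴴ j k) * (w i k : ℂ)‖ ^ 2 := fun w => by
    have h1 : ∀ j, Ψ.mulVec (fun j' => lam j' * S w j') j - (θ j : ℂ)
        = Ψ.mulVec ((fun j' => lam j' * S w j') - β) j := fun j => by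
      rw [mulVec_sub, ← hθ]; rfl
    simp_rw [h1]
    rw [sum_norm_sq_mulVec hΨ.2]
    refine Finset.sum_congr rfl fun j _ => ?_
    congr 2
    simp only [Pi.sub_apply, hS, mulVec, dotProduct, mul_add, Finset.mul_sum]
    simp only [mul_assoc]
    ring
  simp_rw [hpt]
  have hint := fun j => integrable_integral_normSq_affine_noiseLaw ((lam j - 1) * β j)
    fun (i : Fin n) k => lam j * c i j * ε * Ψᴴ j k
  rw [integral_finsetSum _ fun j _ => (hint j).1]
  refine Finset.sum_congr rfl fun j _ => ?_
  have hcol : ∑ k, ‖Ψᴴ j k‖ ^ 2 = 1 := by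
    have h := congrFun (congrFun hΨ.2 j) j
    rw [mul_apply, one_apply_eq] at h
    have h' : ((∑ k, ‖Ψᴴ j k‖ ^ 2 : ℝ) : ℂ) = 1 := by
      rw [← h]
      push_cast
      refine Finset.sum_congr rfl fun k _ => ?_
      rw [conjTranspose_apply, norm_star, ← Complex.conj_mul']
      rfl
    exact_mod_cast h'
  rw [(hint j).2]
  simp_rw [norm_mul, mul_pow, ← Finset.mul_sum, hcol]
  rw [Complex.norm_real, Real.norm_eq_abs, sq_abs, Finset.mul_sum, Finset.sum_mul]
  congr 1
  exact Finset.sum_congr rfl fun i _ => by ring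

/-- Completing the square in a complex shrinkage factor. -/
lemma norm_sub_one_sq_mul_add {b t : ℝ} (hb : 0 ≤ b) (ht : 0 < t) (z : ℂ) :
    ‖z - 1‖ ^ 2 * b + t * ‖z‖ ^ 2
      = (b + t) * ‖z - ((b / (b + t) : ℝ) : ℂ)‖ ^ 2 + b * t / (b + t) := by
  have h : b + t ≠ 0 := by positivity
  simp only [← Complex.normSq_eq_norm_sq, Complex.normSq_apply, Complex.sub_re, Complex.sub_im,
    Complex.ofReal_re, Complex.ofReal_im, Complex.one_re, Complex.one_im]
  field_simp
  ring

/-- The oracle risk in closed form. -/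
lemma iInf_sum_shrinkage {ι : Type*} [Fintype ι] {b t : ι → ℝ} (hb : ∀ j, 0 ≤ b j)
    (ht : ∀ j, 0 < t j) :
    ⨅ lam : ι → ℂ, ∑ j, (‖lam j - 1‖ ^ 2 * b j + t j * ‖lam j‖ ^ 2)
      = ∑ j, b j * t j / (b j + t j) := by
  simp_rw [fun j (z : ℂ) => norm_sub_one_sq_mul_add (hb j) (ht j) z]
  have hlb : ∀ lam : ι → ℂ, ∑ j, b j * t j / (b j + t j)
      ≤ ∑ j, ((b j + t j) * ‖lam j - ((b j / (b j + t j) : ℝ) : ℂ)‖ ^ 2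
        + b j * t j / (b j + t j)) := fun lam =>
    Finset.sum_le_sum fun j _ => le_add_of_nonneg_left <|
      mul_nonneg (add_nonneg (hb j) (ht j).le) (sq_nonneg _)
  refine le_antisymm ?_ (le_ciInf hlb)
  refine (ciInf_le ⟨_, Set.forall_mem_range.2 hlb⟩
    fun j => ((b j / (b j + t j) : ℝ) : ℂ)).trans_eq ?_
  simp

/-- Decomposition of a sum of squared moduli around the mean. -/
lemma sum_norm_sq_eq_mean {n : ℕ} (hn : 1 ≤ n) (z : Fin n → ℂ) :
    ∑ i, ‖z i‖ ^ 2 = n * ‖(∑ i, z i) / n‖ ^ 2 + ∑ i, ‖z i - (∑ i, z i) / n‖ ^ 2 := by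
  have hn0 : (n : ℂ) ≠ 0 := by exact_mod_cast (by lia : n ≠ 0)
  obtain ⟨m, hm⟩ : ∃ m, m = (∑ i, z i) / n := ⟨_, rfl⟩
  have hs : ∑ i, z i = n * m := by rw [hm]; field_simp
  have hre := congrArg Complex.re hs
  have him := congrArg Complex.im hs
  simp only [Complex.re_sum, Complex.im_sum, Complex.mul_re, Complex.mul_im,
    Complex.natCast_re, Complex.natCast_im, zero_mul, sub_zero, add_zero] at hre him
  rw [← hm]
  have hexp : ∀ i, ‖z i - m‖ ^ 2
      = ‖z i‖ ^ 2 - 2 * m.re * (z i).re - 2 * m.im * (z i).im + ‖m‖ ^ 2 := fun i => by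
    simp only [← Complex.normSq_eq_norm_sq, Complex.normSq_apply, Complex.sub_re,
      Complex.sub_im]
    ring
  simp_rw [hexp, Finset.sum_add_distrib, Finset.sum_sub_distrib, ← Finset.mul_sum, hre, him]
  simp only [← Complex.normSq_eq_norm_sq, Complex.normSq_apply, Finset.sum_const,
    Finset.card_univ, Fintype.card_fin, nsmul_eq_mul]
  ring

/-- The oracle risk is nondecreasing in the noise level. -/
lemma shrinkage_le {b s t : ℝ} (hb : 0 ≤ b) (hs : 0 < s) (hst : s ≤ t) :
    b * s / (b + s) ≤ b * t / (b + t) := by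
  have ht := hs.trans_le hst
  rw [div_le_div_iff₀ (by positivity) (by positivity)]
  nlinarith [mul_nonneg (sq_nonneg b) (sub_nonneg.2 hst)]

/-- The oracle risk of a nonzero component is increasing in the noise level. -/
lemma shrinkage_lt {b s t : ℝ} (hb : 0 < b) (hs : 0 < s) (hst : s < t) :
    b * s / (b + s) < b * t / (b + t) := by
  have ht := hs.trans hst
  rw [div_lt_div_iff₀ (by positivity) (by positivity)]
  nlinarith [mul_pos (pow_pos hb 2) (sub_pos.2 hst)]

/-- Averaging the observations is statistically suboptimal: the oracle linear risk `R₁`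
based on the combined statistic `B_n` never exceeds the oracle linear risk `R₂` based on
the averaged statistic `B̄_n`, and the inequality is strict whenever some component
`β_j ≠ 0` has non-constant eigenvalues `D_{1j}, …, D_{nj}`. -/
theorem averaging_is_suboptimal
    (p n : ℕ) (hp : 1 ≤ p) (hn : 1 ≤ n)
    (θ : Fin p → ℝ) (ε : ℝ) (hε : 0 < ε)
    (Ψ : Matrix (Fin p) (Fin p) ℂ) (hΨ : Ψ * Ψᴴ = 1 ∧ Ψᴴ * Ψ = 1)
    (D : Fin n → Fin p → ℂ)
    (Δ : Fin p → ℝ) (hΔ : ∀ j, Δ j = ∑ i, ‖D i j‖ ^ 2)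
    (hΔpos : ∀ j, 0 < Δ j)
    (β : Fin p → ℂ) (hβ : β = Ψᴴ.mulVec fun j => (θ j : ℂ))
    (X : (Fin n → Fin p → ℝ) → Fin n → Fin p → ℂ)
    (hX : ∀ w i j, X w i j
      = D i j * β j + (ε : ℂ) * (Ψᴴ.mulVec fun k => ((w i k : ℝ) : ℂ)) j)
    (B : (Fin n → Fin p → ℝ) → Fin p → ℂ)
    (hB : ∀ w j, B w j = (∑ i, (starRingEnd ℂ) (D i j) * X w i j) / (Δ j : ℂ))
    -- the averaged eigenvalues, assumed nonzero
    (Dbar : Fin p → ℂ) (hDbar : ∀ j, Dbar j = (∑ i, D i j) / n)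
    (hDbarNe : ∀ j, Dbar j ≠ 0)
    -- the averaged statistic `B̄_n`
    (Bbar : (Fin n → Fin p → ℝ) → Fin p → ℂ)
    (hBbar : ∀ w j, Bbar w j
      = (starRingEnd ℂ) (Dbar j) * ((∑ i, X w i j) / n) / ((‖Dbar j‖ ^ 2 : ℝ) : ℂ))
    -- the two oracle linear risks
    (R₁ R₂ : ℝ)
    (hR₁ : R₁ = ⨅ lam : Fin p → ℂ,
      ∫ w, (∑ j, ‖Ψ.mulVec (fun j' => lam j' * B w j') j - (θ j : ℂ)‖ ^ 2)
        ∂(noiseLaw n p))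
    (hR₂ : R₂ = ⨅ lam : Fin p → ℂ,
      ∫ w, (∑ j, ‖Ψ.mulVec (fun j' => lam j' * Bbar w j') j - (θ j : ℂ)‖ ^ 2)
        ∂(noiseLaw n p)) :
    R₁ ≤ R₂ ∧
      ((∃ j, β j ≠ 0 ∧ ∃ i i' : Fin n, D i j ≠ D i' j) → R₁ < R₂) := by
  have hn0 : (n : ℂ) ≠ 0 := by exact_mod_cast (by lia : n ≠ 0)
  have hnpos : (0 : ℝ) < n := by exact_mod_cast hn
  have hΔ0 : ∀ j, (Δ j : ℂ) ≠ 0 := fun j => by exact_mod_cast (hΔpos j).ne'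
  have hSB : ∀ w j, B w j = β j + ∑ i, ((starRingEnd ℂ) (D i j) / Δ j)
      * ((ε : ℂ) * (Ψᴴ.mulVec fun k => ((w i k : ℝ) : ℂ)) j) := fun w j => by
    have hcs : ∑ i, (starRingEnd ℂ) (D i j) * D i j = (Δ j : ℂ) := by
      rw [hΔ]
      push_cast
      exact Finset.sum_congr rfl fun i _ => Complex.conj_mul' _
    simp_rw [hB, hX, mul_add, Finset.sum_add_distrib, ← mul_assoc, ← Finset.sum_mul, hcs]
    rw [add_div, mul_div_cancel_left₀ _ (hΔ0 j), Finset.sum_div]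
    congr 1
    exact Finset.sum_congr rfl fun i _ => by ring
  have hSBbar : ∀ w j, Bbar w j = β j + ∑ i, (1 / (n * Dbar j))
      * ((ε : ℂ) * (Ψᴴ.mulVec fun k => ((w i k : ℝ) : ℂ)) j) := fun w j => by
    have hs : ∑ i, D i j = n * Dbar j := by rw [hDbar]; field_simp
    have hc : (starRingEnd ℂ) (Dbar j) ≠ 0 := by simpa using hDbarNe j
    have hd := hDbarNe j
    rw [hBbar]
    push_cast
    rw [← Complex.conj_mul']
    simp_rw [hX, Finset.sum_add_distrib, ← Finset.sum_mul, hs, ← Finset.mul_sum]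
    field_simp
  have hv₁ : ∀ j, ∑ i, ‖(starRingEnd ℂ) (D i j) / (Δ j : ℂ)‖ ^ 2 = 1 / Δ j := fun j => by
    have h := (hΔpos j).ne'
    simp_rw [norm_div, Complex.norm_conj, Complex.norm_real, Real.norm_eq_abs, div_pow, sq_abs]
    rw [← Finset.sum_div, ← hΔ]
    field_simp
  have hv₂ : ∀ j, ∑ _i : Fin n, ‖1 / ((n : ℂ) * Dbar j)‖ ^ 2 = 1 / (n * ‖Dbar j‖ ^ 2) :=
      fun j => by
    have h := norm_ne_zero_iff.2 (hDbarNe j)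
    simp only [Finset.sum_const, Finset.card_univ, Fintype.card_fin, nsmul_eq_mul, norm_div,
      norm_one, norm_mul, Complex.norm_natCast]
    field_simp
  have hdpos : ∀ j, 0 < n * ‖Dbar j‖ ^ 2 := fun j =>
    mul_pos hnpos (pow_pos (norm_pos_iff.2 (hDbarNe j)) 2)
  have ht₁ : ∀ j, 0 < ε ^ 2 * (1 / Δ j) := fun j =>
    mul_pos (pow_pos hε 2) (one_div_pos.2 (hΔpos j))
  have ht₂ : ∀ j, 0 < ε ^ 2 * (1 / (n * ‖Dbar j‖ ^ 2)) := fun j =>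
    mul_pos (pow_pos hε 2) (one_div_pos.2 (hdpos j))
  have hb : ∀ j, 0 ≤ ‖β j‖ ^ 2 := fun j => sq_nonneg _
  simp_rw [integral_risk_eq hΨ hβ _ hSB, hv₁] at hR₁
  simp_rw [integral_risk_eq hΨ hβ (fun _ j => 1 / (n * Dbar j)) hSBbar, hv₂] at hR₂
  rw [iInf_sum_shrinkage hb ht₁] at hR₁
  rw [iInf_sum_shrinkage hb ht₂] at hR₂
  have hdec : ∀ j, Δ j = n * ‖Dbar j‖ ^ 2 + ∑ i, ‖D i j - Dbar j‖ ^ 2 := fun j => by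
    rw [hΔ, hDbar]
    exact sum_norm_sq_eq_mean hn fun i => D i j
  have hnn : ∀ j, ∀ i ∈ Finset.univ, 0 ≤ ‖D i j - Dbar j‖ ^ 2 := fun _ _ _ => sq_nonneg _
  have hterm : ∀ j, ε ^ 2 * (1 / Δ j) ≤ ε ^ 2 * (1 / (n * ‖Dbar j‖ ^ 2)) := fun j => by
    refine mul_le_mul_of_nonneg_left (one_div_le_one_div_of_le (hdpos j) ?_) (sq_nonneg ε)
    rw [hdec]
    exact le_add_of_nonneg_right (Finset.sum_nonneg (hnn j))
  rw [hR₁, hR₂]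
  refine ⟨Finset.sum_le_sum fun j _ => shrinkage_le (hb j) (ht₁ j) (hterm j), ?_⟩
  rintro ⟨j, hβj, i, i', hii⟩
  refine Finset.sum_lt_sum (fun j _ => shrinkage_le (hb j) (ht₁ j) (hterm j))
    ⟨j, Finset.mem_univ j, shrinkage_lt (pow_pos (norm_pos_iff.2 hβj) 2) (ht₁ j) ?_⟩
  refine mul_lt_mul_of_pos_left (one_div_lt_one_div_of_lt (hdpos j) ?_) (pow_pos hε 2)
  rw [hdec]
  refine lt_add_of_pos_right _ ((Finset.sum_pos_iff_of_nonneg (hnn j)).2 ?_)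
  by_contra! h
  have heq : ∀ l, D l j = Dbar j := fun l => by
    have h' := le_antisymm (h l (Finset.mem_univ l)) (sq_nonneg _)
    simpa [sub_eq_zero] using h'
  exact hii ((heq i).trans (heq i').symm)
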